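/- arXiv:1809.08159 — 4 statements merged into one kernel-verified Lean document; each statement's English description precedes it below -/
import Mathlib

section
/- Let H and G be real Hilbert spaces, Ω a topological space with Borel σ-algebra, and P a Borel probability measure on Ω with P(Ω \ supp(P)) = 0. Let Φ: Ω → H and Ψ: Ω → G be bounded continuous maps, and define the covariance operator C_ΦΦ: H → H by C_ΦΦ f = ∫ ⟨Φ(y), f⟩ Φ(y) dP(y) and the cross-covariance operator C_ΨΦ: H → G by C_ΨΦ f = ∫ ⟨Φ(y), f⟩ Ψ(y) dP(y) (Bochner integrals). Let M ⊆ H be the closed linear span of {Φ(y) : y ∈ supp(P)}. Then for every ε > 0 and every g ∈ H, letting h* be the orthogonal projection of g onto M, one has C_ΨΦ (C_ΦΦ + εI)⁻¹ g = C_ΨΦ (C_ΦΦ + εI)⁻¹ h*. -/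
open MeasureTheory
open scoped RealInnerProductSpace

/-- The topological support of a measure: points all of whose neighborhoods
have positive measure. -/
def measSupport {Ω : Type*} [TopologicalSpace Ω] [MeasurableSpace Ω]
    (P : Measure Ω) : Set Ω :=
  {y | ∀ U ∈ nhds y, 0 < P U}

/-- Lemma 1 of the paper, Hilbert-space form: if `P` puts no mass
outside its support, `Φ, Ψ` are bounded continuous feature maps, `C_ΦΦ` and `C_ΨΦ`
are the associated (cross-)covariance operators, `M` is the closed linear span of the
features over the support of `P`, and `h*` is the orthogonal projection of `g` onto `M`
(characterized by `h* ∈ M` and `g - h* ⟂ M`), then for every `ε > 0`,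
`C_ΨΦ (C_ΦΦ + εI)⁻¹ g = C_ΨΦ (C_ΦΦ + εI)⁻¹ h*`; here the application of the inverse
is expressed via preimages `f, f'` of `g` and `h*` under `C_ΦΦ + εI`. -/
theorem stmt_0
    {H G Ω : Type*}
    [NormedAddCommGroup H] [InnerProductSpace ℝ H] [CompleteSpace H]
    [NormedAddCommGroup G] [InnerProductSpace ℝ G] [CompleteSpace G]
    [TopologicalSpace Ω] [MeasurableSpace Ω] [BorelSpace Ω]
    (P : Measure Ω) [IsProbabilityMeasure P]
    (hsupp : P (measSupport P)ᶜ = 0)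
    (Φ : Ω → H) (Ψ : Ω → G)
    (hΦc : Continuous Φ) (hΨc : Continuous Ψ)
    (hΦb : ∃ B : ℝ, ∀ y, ‖Φ y‖ ≤ B) (hΨb : ∃ B : ℝ, ∀ y, ‖Ψ y‖ ≤ B)
    (Cφφ : H →L[ℝ] H) (hCφφ : ∀ f, Cφφ f = ∫ y, ⟪Φ y, f⟫ • Φ y ∂P)
    (Cψφ : H →L[ℝ] G) (hCψφ : ∀ f, Cψφ f = ∫ y, ⟪Φ y, f⟫ • Ψ y ∂P)
    (M : Submodule ℝ H)
    (hM : M = (Submodule.span ℝ (Φ '' measSupport P)).topologicalClosure)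
    (ε : ℝ) (hε : 0 < ε)
    (g hstar : H)
    (hmem : hstar ∈ M)
    (horth : ∀ v ∈ M, ⟪g - hstar, v⟫ = 0)
    (f f' : H)
    (hf : Cφφ f + ε • f = g)
    (hf' : Cφφ f' + ε • f' = hstar) :
    Cψφ f = Cψφ f' := by
  have hae : ∀ᵐ y ∂P, ⟪g - hstar, Φ y⟫ = 0 := by
    have h1 : ∀ᵐ y ∂P, y ∈ measSupport P := hsupp
    filter_upwards [h1] with y hy
    apply horth
    rw [hM]
    exact Submodule.le_topologicalClosure _ (Submodule.subset_span ⟨y, hy, rfl⟩)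
  obtain ⟨u, hu⟩ : ∃ u, u = f - f' := ⟨_, rfl⟩
  have hw : Cφφ u + ε • u = g - hstar := by
    rw [hu, map_sub, smul_sub, ← hf, ← hf']; abel
  have hpos : 0 ≤ ⟪u, Cφφ u⟫ := by
    rw [hCφφ]
    by_cases hi : Integrable (fun y => ⟪Φ y, u⟫ • Φ y) P
    · rw [← integral_inner hi]
      apply integral_nonneg
      intro y
      simp only [Pi.zero_apply, inner_smul_right]
      rw [real_inner_comm]
      exact mul_self_nonneg _
    · rw [integral_undef hi, inner_zero_right]
  have hz : ⟪g - hstar, Cφφ u⟫ = 0 := by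
    rw [hCφφ]
    by_cases hi : Integrable (fun y => ⟪Φ y, u⟫ • Φ y) P
    · rw [← integral_inner hi]
      apply integral_eq_zero_of_ae
      filter_upwards [hae] with y hy
      simp [inner_smul_right, hy]
    · rw [integral_undef hi, inner_zero_right]
  have hC : Cφφ u = 0 := by
    rw [← hw, inner_add_left, inner_smul_left] at hz
    simp only [conj_trivial] at hz
    have h0 := mul_nonneg hε.le hpos
    have h1 := real_inner_self_nonneg (x := Cφφ u)
    exact inner_self_eq_zero (𝕜 := ℝ).1 (by linarith)
  rw [hC, zero_add] at hw
  have hfin : Cψφ u = 0 := by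
    rw [hCψφ]
    apply integral_eq_zero_of_ae
    filter_upwards [hae] with y hy
    rw [← hw, inner_smul_left] at hy
    have h2 : ⟪u, Φ y⟫ = 0 := by
      rcases mul_eq_zero.1 hy with h | h
      · exact absurd h hε.ne'
      · exact h
    rw [real_inner_comm] at h2
    simp [h2]
  rw [hu, map_sub] at hfin
  exact sub_eq_zero.1 hfin
end

section
/- Let H and G be real Hilbert spaces, Ω a topological space with Borel σ-algebra, and P a Borel probability measure on Ω with P(Ω \ supp(P)) = 0. Let Φ: Ω → H and Ψ: Ω → G be bounded continuous maps, and define C_ΦΦ f = ∫ ⟨Φ(y), f⟩ Φ(y) dP(y) and C_ΨΦ f = ∫ ⟨Φ(y), f⟩ Ψ(y) dP(y). Let M ⊆ H be the closed linear span of {Φ(y) : y ∈ supp(P)}, let g ∈ H, and let h* be the orthogonal projection of g onto M. Assume the identifiability condition: there exists y* ∈ supp(P) such that Φ(y*) = h*. Then for every ε > 0, C_ΨΦ (C_ΦΦ + εI)⁻¹ g = C_ΨΦ (C_ΦΦ + εI)⁻¹ Φ(y*). -/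
open MeasureTheory
open scoped RealInnerProductSpace

/-- Theorem 1 of the paper, Hilbert-space form: under the setup of
Lemma 1 and the identifiability assumption that the orthogonal projection `h*` of `g`
onto the closed span `M` of the features over the support of `P` is realized as
`h* = Φ(y*)` for some `y*` in the support of `P`, one has for every `ε > 0`
`C_ΨΦ (C_ΦΦ + εI)⁻¹ g = C_ΨΦ (C_ΦΦ + εI)⁻¹ Φ(y*)`; the application of the inverse is
expressed via preimages `f, f'` of `g` and `Φ(y*)` under `C_ΦΦ + εI`. -/
theorem stmt_1
    {H G Ω : Type*}
    [NormedAddCommGroup H] [InnerProductSpace ℝ H] [CompleteSpace H]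
    [NormedAddCommGroup G] [InnerProductSpace ℝ G] [CompleteSpace G]
    [TopologicalSpace Ω] [MeasurableSpace Ω] [BorelSpace Ω]
    (P : Measure Ω) [IsProbabilityMeasure P]
    (hsupp : P (measSupport P)ᶜ = 0)
    (Φ : Ω → H) (Ψ : Ω → G)
    (hΦc : Continuous Φ) (hΨc : Continuous Ψ)
    (hΦb : ∃ B : ℝ, ∀ y, ‖Φ y‖ ≤ B) (hΨb : ∃ B : ℝ, ∀ y, ‖Ψ y‖ ≤ B)
    (Cφφ : H →L[ℝ] H) (hCφφ : ∀ f, Cφφ f = ∫ y, ⟪Φ y, f⟫ • Φ y ∂P)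
    (Cψφ : H →L[ℝ] G) (hCψφ : ∀ f, Cψφ f = ∫ y, ⟪Φ y, f⟫ • Ψ y ∂P)
    (M : Submodule ℝ H)
    (hM : M = (Submodule.span ℝ (Φ '' measSupport P)).topologicalClosure)
    (g hstar : H)
    (hmem : hstar ∈ M)
    (horth : ∀ v ∈ M, ⟪g - hstar, v⟫ = 0)
    (ystar : Ω) (hystar : ystar ∈ measSupport P) (hident : Φ ystar = hstar)
    (ε : ℝ) (hε : 0 < ε)
    (f f' : H)
    (hf : Cφφ f + ε • f = g)
    (hf' : Cφφ f' + ε • f' = Φ ystar) :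
    Cψφ f = Cψφ f' := by
  have hae : ∀ᵐ y ∂P, y ∈ measSupport P := by
    rw [ae_iff]; exact hsupp
  have hΦM : ∀ y ∈ measSupport P, Φ y ∈ M := by
    intro y hy
    rw [hM]
    exact Submodule.le_topologicalClosure _ (Submodule.subset_span ⟨y, hy, rfl⟩)
  -- the difference of the two preimages
  have hd : Cφφ (f - f') + ε • (f - f') = g - hstar := by
    rw [map_sub, smul_sub, ← hident, ← hf, ← hf']
    abel
  generalize hde : f - f' = d at hd
  -- `Cφφ d = 0`
  have hC0 : Cφφ d = 0 := by
    by_cases hint : Integrable (fun y => ⟪Φ y, d⟫ • Φ y) P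
    · have hin : ∀ c : H, ⟪c, Cφφ d⟫ = ∫ y, ⟪c, ⟪Φ y, d⟫ • Φ y⟫ ∂P := by
        intro c
        rw [hCφφ d]
        exact (integral_inner hint c).symm
      have h1 : ⟪g - hstar, Cφφ d⟫ = 0 := by
        rw [hin]
        apply integral_eq_zero_of_ae
        filter_upwards [hae] with y hy
        simp [real_inner_smul_right, horth _ (hΦM y hy)]
      have h2 : 0 ≤ ⟪d, Cφφ d⟫ := by
        rw [hin]
        apply integral_nonneg
        intro y
        simp only [real_inner_smul_right, Pi.zero_apply]
        rw [real_inner_comm]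
        exact mul_self_nonneg _
      rw [← hd, inner_add_left, real_inner_smul_left, real_inner_self_eq_norm_sq] at h1
      have h3 : ‖Cφφ d‖ ^ 2 = 0 := by
        have := mul_nonneg hε.le h2
        have := sq_nonneg ‖Cφφ d‖
        linarith
      simpa using h3
    · rw [hCφφ d]
      exact integral_undef hint
  rw [hC0, zero_add] at hd
  -- hence `d` is orthogonal to the features on the support
  have hz : ∀ y ∈ measSupport P, ⟪Φ y, d⟫ = 0 := by
    intro y hy
    have h := horth _ (hΦM y hy)
    rw [← hd, real_inner_smul_left, real_inner_comm] at h
    exact (mul_eq_zero.mp h).resolve_left hε.ne'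
  rw [← sub_eq_zero, ← map_sub, hde, hCψφ d]
  apply integral_eq_zero_of_ae
  filter_upwards [hae] with y hy
  simp [hz y hy]
end

section
/- Let H and G be real Hilbert spaces, ε > 0, and let C, Ĉ be positive self-adjoint bounded operators on H, and T, T̂: H → G bounded operators. Assume there exist a positive self-adjoint bounded operator D on G and a bounded operator W: H → G with ‖W‖ ≤ 1 such that T̂ = D^{1/2} ∘ W ∘ Ĉ^{1/2}. Then ‖T̂ (Ĉ + εI)⁻¹ − T (C + εI)⁻¹‖ ≤ ‖D^{1/2}‖ · ε^{−1/2} · ‖(C − Ĉ)(C + εI)⁻¹‖ + ‖(T̂ − T)(C + εI)⁻¹‖, where ‖·‖ denotes the operator norm. -/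
open scoped RealInnerProductSpace

/-- estimation-error decomposition in the proof of Theorem 2: for
positive self-adjoint bounded operators `C, Ĉ` on `H`, bounded operators
`T, T̂ : H → G`, and a factorization `T̂ = D^{1/2} ∘ W ∘ Ĉ^{1/2}` with `D` positive
self-adjoint and `‖W‖ ≤ 1`, one has
`‖T̂(Ĉ + εI)⁻¹ − T(C + εI)⁻¹‖ ≤ ‖D^{1/2}‖ ε^{−1/2} ‖(C − Ĉ)(C + εI)⁻¹‖ + ‖(T̂ − T)(C + εI)⁻¹‖`.
The square roots `D^{1/2}, Ĉ^{1/2}` are the (unique) positive self-adjoint operators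
squaring to `D, Ĉ`, and the inverses `R, R̂` of `C + εI, Ĉ + εI` are characterized by
the two-sided inverse equations. -/
theorem stmt_6
    {H G : Type*}
    [NormedAddCommGroup H] [InnerProductSpace ℝ H] [CompleteSpace H]
    [NormedAddCommGroup G] [InnerProductSpace ℝ G] [CompleteSpace G]
    (ε : ℝ) (hε : 0 < ε)
    (C Chat : H →L[ℝ] H)
    (hCsa : ∀ x y, ⟪C x, y⟫ = ⟪x, C y⟫) (hCpos : ∀ x, 0 ≤ ⟪C x, x⟫)
    (hChatsa : ∀ x y, ⟪Chat x, y⟫ = ⟪x, Chat y⟫) (hChatpos : ∀ x, 0 ≤ ⟪Chat x, x⟫)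
    (T That : H →L[ℝ] G)
    (D : G →L[ℝ] G)
    (hDsa : ∀ x y, ⟪D x, y⟫ = ⟪x, D y⟫) (hDpos : ∀ x, 0 ≤ ⟪D x, x⟫)
    (sqrtD : G →L[ℝ] G)
    (hsqrtDsa : ∀ x y, ⟪sqrtD x, y⟫ = ⟪x, sqrtD y⟫)
    (hsqrtDpos : ∀ x, 0 ≤ ⟪sqrtD x, x⟫)
    (hsqrtD : sqrtD ∘L sqrtD = D)
    (sqrtChat : H →L[ℝ] H)
    (hsqrtChatsa : ∀ x y, ⟪sqrtChat x, y⟫ = ⟪x, sqrtChat y⟫)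
    (hsqrtChatpos : ∀ x, 0 ≤ ⟪sqrtChat x, x⟫)
    (hsqrtChat : sqrtChat ∘L sqrtChat = Chat)
    (W : H →L[ℝ] G) (hW : ‖W‖ ≤ 1)
    (hfact : That = sqrtD ∘L (W ∘L sqrtChat))
    (R Rhat : H →L[ℝ] H)
    (hR1 : (C + ε • (1 : H →L[ℝ] H)) ∘L R = 1)
    (hR2 : R ∘L (C + ε • (1 : H →L[ℝ] H)) = 1)
    (hRhat1 : (Chat + ε • (1 : H →L[ℝ] H)) ∘L Rhat = 1)
    (hRhat2 : Rhat ∘L (Chat + ε • (1 : H →L[ℝ] H)) = 1) :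
    ‖That ∘L Rhat - T ∘L R‖ ≤
      ‖sqrtD‖ * ε ^ (-(1/2 : ℝ)) * ‖(C - Chat) ∘L R‖ + ‖(That - T) ∘L R‖ := by
  have hε' : (0:ℝ) ≤ ε ^ (-(1/2 : ℝ)) := Real.rpow_nonneg hε.le _
  have hsq : (ε ^ (-(1/2 : ℝ))) ^ 2 = ε⁻¹ := by
    rw [← Real.rpow_natCast, ← Real.rpow_mul hε.le]
    norm_num [Real.rpow_neg_one]
  have hS : ‖sqrtChat ∘L Rhat‖ ≤ ε ^ (-(1/2 : ℝ)) := by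
    refine ContinuousLinearMap.opNorm_le_bound _ hε' (fun x => ?_)
    have hx : Chat (Rhat x) + ε • Rhat x = x := by
      have := congrArg (fun A : H →L[ℝ] H => A x) hRhat1
      simpa using this
    have hSy : ⟪Chat (Rhat x), Rhat x⟫ = ‖sqrtChat (Rhat x)‖ ^ 2 := by
      rw [← hsqrtChat, ContinuousLinearMap.comp_apply, hsqrtChatsa, real_inner_self_eq_norm_sq]
    have hn : ‖x‖ ^ 2 = ‖Chat (Rhat x)‖ ^ 2 + 2 * (ε * ‖sqrtChat (Rhat x)‖ ^ 2)
        + ‖ε • Rhat x‖ ^ 2 := by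
      conv_lhs => rw [← hx]
      rw [norm_add_sq_real, real_inner_smul_right, hSy]
    have hle : ε * ‖sqrtChat (Rhat x)‖ ^ 2 ≤ ‖x‖ ^ 2 := by
      have h1 := sq_nonneg ‖Chat (Rhat x)‖
      have h2 := sq_nonneg ‖ε • Rhat x‖
      have h3 : 0 ≤ ε * ‖sqrtChat (Rhat x)‖ ^ 2 := by positivity
      linarith
    rw [ContinuousLinearMap.comp_apply]
    refine (sq_le_sq₀ (norm_nonneg _) (by positivity)).1 ?_
    rw [mul_pow, hsq, inv_mul_eq_div, le_div_iff₀ hε]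
    linarith
  have hdiff : Rhat - R = Rhat ∘L ((C - Chat) ∘L R) := by
    have h : (C - Chat) ∘L R = 1 - (Chat + ε • (1 : H →L[ℝ] H)) ∘L R := by
      refine Eq.trans ?_ (congrArg (fun A => A - (Chat + ε • (1 : H →L[ℝ] H)) ∘L R) hR1)
      simp only [← ContinuousLinearMap.sub_comp]
      congr 1
      abel
    rw [h, ContinuousLinearMap.comp_sub, ← ContinuousLinearMap.comp_assoc, hRhat2]
    rfl
  have hdec : That ∘L Rhat - T ∘L R =
      sqrtD ∘L (W ∘L ((sqrtChat ∘L Rhat) ∘L ((C - Chat) ∘L R))) + (That - T) ∘L R := by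
    have h : sqrtD ∘L (W ∘L ((sqrtChat ∘L Rhat) ∘L ((C - Chat) ∘L R)))
        = That ∘L (Rhat - R) := by
      rw [hdiff, hfact]
      rfl
    rw [h, ContinuousLinearMap.comp_sub, ContinuousLinearMap.sub_comp]
    abel
  rw [hdec]
  refine (norm_add_le _ _).trans (add_le_add ?_ le_rfl)
  calc ‖sqrtD ∘L (W ∘L ((sqrtChat ∘L Rhat) ∘L ((C - Chat) ∘L R)))‖
      ≤ ‖sqrtD‖ * (‖W‖ * (‖sqrtChat ∘L Rhat‖ * ‖(C - Chat) ∘L R‖)) := by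
        refine (ContinuousLinearMap.opNorm_comp_le _ _).trans ?_
        gcongr
        refine (ContinuousLinearMap.opNorm_comp_le _ _).trans ?_
        gcongr
        exact ContinuousLinearMap.opNorm_comp_le _ _
    _ ≤ ‖sqrtD‖ * (1 * (ε ^ (-(1/2 : ℝ)) * ‖(C - Chat) ∘L R‖)) := by
        gcongr
    _ = ‖sqrtD‖ * ε ^ (-(1/2 : ℝ)) * ‖(C - Chat) ∘L R‖ := by ring
end

section
/- Let H and G be real Hilbert spaces, A a positive self-adjoint bounded operator on H, B a positive self-adjoint bounded operator on G, and T: H → G a bounded operator satisfying |⟨T f, g⟩|² ≤ ⟨A f, f⟩ · ⟨B g, g⟩ for all f ∈ H and g ∈ G. Then there exists a bounded operator W: H → G with ‖W‖ ≤ 1 such that T = B^{1/2} ∘ W ∘ A^{1/2}, where A^{1/2} and B^{1/2} are the positive square roots of A and B. -/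
open scoped RealInnerProductSpace

theorem douglas_aux {E F G : Type*}
    [NormedAddCommGroup E] [NormedSpace ℝ E]
    [NormedAddCommGroup F] [InnerProductSpace ℝ F] [CompleteSpace F]
    [NormedAddCommGroup G] [InnerProductSpace ℝ G] [CompleteSpace G]
    (S : E →L[ℝ] F) (T : E →L[ℝ] G) (c : ℝ) (hc : 0 ≤ c) (h : ∀ x, ‖T x‖ ≤ c * ‖S x‖) :
    ∃ W : F →L[ℝ] G, ‖W‖ ≤ c ∧ (∀ x, W (S x) = T x) ∧
      ∀ u, ∃ v ∈ closure (Set.range S), ‖v‖ ≤ ‖u‖ ∧ W u = W v := by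
  let K : Submodule ℝ F := (LinearMap.range (S : E →ₗ[ℝ] F)).topologicalClosure
  have hK : ∀ x, S x ∈ K := fun x => Submodule.le_topologicalClosure _ ⟨x, rfl⟩
  have hKset : (K : Set F) = closure (Set.range S) := by
    rw [Submodule.topologicalClosure_coe]
    rfl
  have : CompleteSpace K := (Submodule.isClosed_topologicalClosure _).completeSpace_coe
  let e : E →ₗ[ℝ] K := (S : E →ₗ[ℝ] F).codRestrict K hK
  have hd : DenseRange e := by
    intro y
    rw [closure_subtype, ← Set.range_comp]
    have := y.2
    rw [← SetLike.mem_coe, hKset] at this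
    exact this
  have hn : ∀ x, ‖(T : E →ₗ[ℝ] G) x‖ ≤ c * ‖e x‖ := h
  let W0 : K →L[ℝ] G := LinearMap.extendOfNorm (T : E →ₗ[ℝ] G) e
  have hW0 : ‖W0‖ ≤ c := LinearMap.opNorm_extendOfNorm_le hd hc hn
  have hWe : ∀ x, W0 (e x) = T x := fun x => LinearMap.extendOfNorm_eq hd ⟨c, hn⟩ x
  refine ⟨W0 ∘L K.orthogonalProjectionOnto, ?_, ?_, ?_⟩
  · refine ContinuousLinearMap.opNorm_le_bound _ hc fun u => ?_
    calc ‖W0 (K.orthogonalProjectionOnto u)‖ ≤ ‖W0‖ * ‖K.orthogonalProjectionOnto u‖ := W0.le_opNorm _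
      _ ≤ c * ‖u‖ := by
        gcongr
        exact K.norm_orthogonalProjectionOnto_apply_le u
  · intro x
    have : K.orthogonalProjectionOnto (S x) = e x :=
      K.orthogonalProjectionOnto_mem_subspace_eq_self (e x)
    simp [this, hWe]
  · intro u
    refine ⟨K.orthogonalProjectionOnto u, ?_, K.norm_orthogonalProjectionOnto_apply_le u, ?_⟩
    · rw [← hKset]; exact (K.orthogonalProjectionOnto u).2
    · rw [ContinuousLinearMap.comp_apply, ContinuousLinearMap.comp_apply,
        K.orthogonalProjectionOnto_mem_subspace_eq_self]

/-- Baker's factorization theorem: if `A`, `B` are positive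
self-adjoint bounded operators on real Hilbert spaces `H`, `G` and a bounded operator
`T : H → G` satisfies `|⟪T f, g⟫|² ≤ ⟪A f, f⟫ ⟪B g, g⟫` for all `f, g`, then there is a
bounded operator `W : H → G` with `‖W‖ ≤ 1` such that `T = B^{1/2} ∘ W ∘ A^{1/2}`,
where `A^{1/2}`, `B^{1/2}` are the (unique) positive self-adjoint square roots of
`A`, `B`. -/
theorem stmt_12
    {H G : Type*}
    [NormedAddCommGroup H] [InnerProductSpace ℝ H] [CompleteSpace H]
    [NormedAddCommGroup G] [InnerProductSpace ℝ G] [CompleteSpace G]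
    (A : H →L[ℝ] H)
    (hAsa : ∀ x y, ⟪A x, y⟫ = ⟪x, A y⟫) (hApos : ∀ x, 0 ≤ ⟪A x, x⟫)
    (B : G →L[ℝ] G)
    (hBsa : ∀ x y, ⟪B x, y⟫ = ⟪x, B y⟫) (hBpos : ∀ x, 0 ≤ ⟪B x, x⟫)
    (T : H →L[ℝ] G)
    (hCS : ∀ (f : H) (g : G), |⟪T f, g⟫| ^ 2 ≤ ⟪A f, f⟫ * ⟪B g, g⟫)
    (sqrtA : H →L[ℝ] H)
    (hsqrtAsa : ∀ x y, ⟪sqrtA x, y⟫ = ⟪x, sqrtA y⟫)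
    (hsqrtApos : ∀ x, 0 ≤ ⟪sqrtA x, x⟫)
    (hsqrtA : sqrtA ∘L sqrtA = A)
    (sqrtB : G →L[ℝ] G)
    (hsqrtBsa : ∀ x y, ⟪sqrtB x, y⟫ = ⟪x, sqrtB y⟫)
    (hsqrtBpos : ∀ x, 0 ≤ ⟪sqrtB x, x⟫)
    (hsqrtB : sqrtB ∘L sqrtB = B) :
    ∃ W : H →L[ℝ] G, ‖W‖ ≤ 1 ∧ T = sqrtB ∘L (W ∘L sqrtA) := by
  have hA : ∀ f, ⟪A f, f⟫ = ‖sqrtA f‖ ^ 2 := fun f => by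
    rw [← hsqrtA, ContinuousLinearMap.comp_apply, hsqrtAsa, real_inner_self_eq_norm_sq]
  have hB : ∀ f, ⟪B f, f⟫ = ‖sqrtB f‖ ^ 2 := fun f => by
    rw [← hsqrtB, ContinuousLinearMap.comp_apply, hsqrtBsa, real_inner_self_eq_norm_sq]
  have key : ∀ f g, |⟪T f, g⟫| ≤ ‖sqrtA f‖ * ‖sqrtB g‖ := fun f g => by
    have h := hCS f g
    rw [hA, hB, ← mul_pow] at h
    exact le_of_sq_le_sq h (by positivity)
  have h1 : ∀ f, ‖T f‖ ≤ ‖sqrtB‖ * ‖sqrtA f‖ := fun f => by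
    have h := key f (T f)
    rw [real_inner_self_eq_norm_mul_norm, abs_of_nonneg (by positivity)] at h
    have h' := sqrtB.le_opNorm (T f)
    rcases (norm_nonneg (T f)).eq_or_lt with h0 | h0
    · rw [← h0]; positivity
    · refine le_of_mul_le_mul_right ?_ h0
      calc _ ≤ _ := h
        _ ≤ ‖sqrtA f‖ * (‖sqrtB‖ * ‖T f‖) := by gcongr
        _ = _ := by ring
  obtain ⟨V, -, hVT, hVp⟩ := douglas_aux sqrtA T ‖sqrtB‖ (norm_nonneg _) h1
  have h2 : ∀ g, ∀ v ∈ closure (Set.range sqrtA), |⟪V v, g⟫| ≤ ‖v‖ * ‖sqrtB g‖ := by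
    intro g v hv
    have hcl : IsClosed {v : H | |⟪V v, g⟫| ≤ ‖v‖ * ‖sqrtB g‖} :=
      isClosed_le (by fun_prop) (by fun_prop)
    refine closure_minimal ?_ hcl hv
    rintro _ ⟨f, rfl⟩
    simpa [hVT] using key f g
  have h3 : ∀ g, ‖ContinuousLinearMap.adjoint V g‖ ≤ 1 * ‖sqrtB g‖ := by
    intro g
    obtain ⟨v, hv, hvn, hVv⟩ := hVp (ContinuousLinearMap.adjoint V g)
    have h := h2 g v hv
    rw [← hVv, ← ContinuousLinearMap.adjoint_inner_right, real_inner_self_eq_norm_mul_norm,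
      abs_of_nonneg (by positivity)] at h
    rcases (norm_nonneg (ContinuousLinearMap.adjoint V g)).eq_or_lt with h0 | h0
    · rw [← h0]; positivity
    · refine le_of_mul_le_mul_left ?_ h0
      calc _ ≤ _ := h
        _ ≤ _ := by rw [one_mul]; gcongr
  obtain ⟨X, hX, hXV, -⟩ := douglas_aux sqrtB (ContinuousLinearMap.adjoint V) 1 zero_le_one h3
  refine ⟨ContinuousLinearMap.adjoint X, ?_, ?_⟩
  · rwa [LinearIsometryEquiv.norm_map]
  · ext f
    refine ext_inner_right ℝ fun g => ?_
    rw [ContinuousLinearMap.comp_apply, ContinuousLinearMap.comp_apply, hsqrtBsa,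
      ContinuousLinearMap.adjoint_inner_left, hXV, ContinuousLinearMap.adjoint_inner_right, hVT]
end
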